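/- arXiv:1304.7515 — 4 statements merged into one kernel-verified Lean document; each statement's English description precedes it below -/
import Mathlib

section
/- For every natural number g ≥ 2, arccosh(1/(√2 · sin(π/(12g−6)))) < log(4g−2) + arcsinh(1). -/
open Real

noncomputable def arccosh (x : ℝ) : ℝ := Real.log (x + Real.sqrt (x ^ 2 - 1))

/-- For positive `x`, `arccosh x` is at most `log (2 * x)`. -/
theorem arccosh_le_log_two_mul {x : ℝ} (hx : 0 < x) : arccosh x ≤ Real.log (2 * x) := by
  have h : √(x ^ 2 - 1) ≤ x := Real.sqrt_le_iff.2 ⟨hx.le, by linarith⟩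
  exact Real.log_le_log (by positivity) (by linarith)

theorem arsinh_one : Real.arsinh 1 = Real.log (1 + √2) := by
  norm_num [Real.arsinh]

theorem stmt_0 (g : ℕ) (hg : 2 ≤ g) :
    arccosh (1 / (Real.sqrt 2 * Real.sin (π / (12 * (g : ℝ) - 6)))) <
      Real.log (4 * (g : ℝ) - 2) + Real.arsinh 1 := by
  have hg' : (2 : ℝ) ≤ g := by exact_mod_cast hg
  set N : ℝ := 4 * (g : ℝ) - 2 with hN
  have hN6 : 6 ≤ N := by linarith
  have hangle : 12 * (g : ℝ) - 6 = 3 * N := by linarith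
  rw [hangle]
  -- Jordan's inequality suffices, since `3 / √2 < 1 + √2`.
  have hsin : 2 / (3 * N) ≤ Real.sin (π / (3 * N)) := by
    have h := Real.mul_le_sin (x := π / (3 * N)) (by positivity)
      (div_le_div_of_nonneg_left pi_pos.le two_pos (by linarith))
    rwa [show 2 / π * (π / (3 * N)) = 2 / (3 * N) by field_simp] at h
  have hsin_pos : 0 < Real.sin (π / (3 * N)) := lt_of_lt_of_le (by positivity) hsin
  refine (arccosh_le_log_two_mul (by positivity)).trans_lt ?_
  rw [arsinh_one, ← Real.log_mul (by positivity) (by positivity)]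
  refine Real.log_lt_log (by positivity) ?_
  rw [mul_one_div, div_lt_iff₀ (by positivity)]
  have hsq : √2 * √2 = 2 := Real.mul_self_sqrt (by norm_num)
  have hsqrt : 1 < √2 := Real.lt_sqrt_of_sq_lt (by norm_num)
  calc (2 : ℝ) < (√2 + 2) * (2 / 3) := by linarith
    _ = N * (1 + √2) * (√2 * (2 / (3 * N))) := by
      field_simp
      linear_combination -hsq
    _ ≤ N * (1 + √2) * (√2 * Real.sin (π / (3 * N))) := by gcongr
end

section
/- Let a > 0, b > 0, t > 0 and 0 ≤ c < 2 · arcsinh(1) be real numbers such that cosh(t/2) = sinh(a/2) · sinh(b/2) · cosh(c) − cosh(a/2) · cosh(b/2). Then t < a + b. -/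
theorem cosh_two_mul_arsinh_one : Real.cosh (2 * Real.arsinh 1) = 3 := by
  rw [Real.cosh_two_mul, Real.cosh_sq, Real.sinh_arsinh]
  norm_num

theorem stmt_7 (a b t c : ℝ) (ha : 0 < a) (hb : 0 < b) (ht : 0 < t)
    (hc0 : 0 ≤ c) (hc : c < 2 * Real.arsinh 1)
    (h : Real.cosh (t / 2) =
      Real.sinh (a / 2) * Real.sinh (b / 2) * Real.cosh c -
        Real.cosh (a / 2) * Real.cosh (b / 2)) :
    t < a + b := by
  have hcosh : Real.cosh c < 3 := by
    rw [← cosh_two_mul_arsinh_one, Real.cosh_lt_cosh, abs_of_nonneg hc0,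
      abs_of_pos (hc0.trans_lt hc)]
    exact hc
  have hsa : 0 < Real.sinh (a / 2) := Real.sinh_pos_iff.2 (half_pos ha)
  have hsb : 0 < Real.sinh (b / 2) := Real.sinh_pos_iff.2 (half_pos hb)
  have hlt : Real.sinh (a / 2) * Real.sinh (b / 2) * Real.cosh c <
      Real.sinh (a / 2) * Real.sinh (b / 2) * 3 :=
    mul_lt_mul_of_pos_left hcosh (mul_pos hsa hsb)
  have hle : Real.sinh (a / 2) * Real.sinh (b / 2) ≤
      Real.cosh (a / 2) * Real.cosh (b / 2) :=
    mul_le_mul (Real.sinh_lt_cosh _).le (Real.sinh_lt_cosh _).le hsb.le (Real.cosh_pos _).le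
  have key : Real.cosh (t / 2) < Real.cosh (a / 2 + b / 2) := by
    rw [h, Real.cosh_add]
    linarith
  rw [Real.cosh_lt_cosh, abs_of_pos (half_pos ht),
    abs_of_pos (add_pos (half_pos ha) (half_pos hb))] at key
  linarith
end

section
/- Let a ≥ 0, b ≥ 0, t ≥ 0 and c ≥ 0 be real numbers such that cosh(t/2) = sinh(a/2) · sinh(b/2) · cosh(c) − cosh(a/2) · cosh(b/2). Then t < a + b + 2c. -/
theorem stmt_9 (a b t c : ℝ) (ha : 0 ≤ a) (hb : 0 ≤ b) (ht : 0 ≤ t) (hc : 0 ≤ c)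
    (h : Real.cosh (t / 2) =
      Real.sinh (a / 2) * Real.sinh (b / 2) * Real.cosh c -
        Real.cosh (a / 2) * Real.cosh (b / 2)) :
    t < a + b + 2 * c := by
  have hlt : Real.cosh (t / 2) < Real.cosh (a / 2 + b / 2 + c) := by
    have hsinh : 0 ≤ Real.sinh (a / 2 + b / 2) * Real.sinh c :=
      mul_nonneg (Real.sinh_nonneg_iff.2 (by positivity)) (Real.sinh_nonneg_iff.2 hc)
    have hab : 0 < Real.cosh (a / 2) * Real.cosh (b / 2) :=
      mul_pos (Real.cosh_pos _) (Real.cosh_pos _)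
    have habc := mul_pos hab (Real.cosh_pos c)
    rw [h, Real.cosh_add (a / 2 + b / 2) c, Real.cosh_add (a / 2) (b / 2), add_mul]
    linarith
  rw [Real.cosh_lt_cosh, abs_of_nonneg (by positivity), abs_of_nonneg (by positivity)] at hlt
  linarith
end

section
/- For every natural number g ≥ 3, 4π(g−1) + 4 · arccosh(1/(√2 · sin(π/(12g−6)))) < 6·√(3π)·(g−1). -/
open Real

theorem log_le_div_exp_two_add_one {t : ℝ} (ht : 0 < t) : Real.log t ≤ t / Real.exp 2 + 1 := by
  have h := Real.log_le_sub_one_of_pos (div_pos ht (Real.exp_pos 2))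
  rw [Real.log_div ht.ne' (Real.exp_pos 2).ne', Real.log_exp] at h
  linarith

theorem lt_exp_two : 7.38 < Real.exp 2 := by
  have h : Real.exp 2 = Real.exp 1 * Real.exp 1 := by rw [← Real.exp_add]; norm_num
  have := Real.exp_one_gt_d9
  nlinarith

theorem mul_lt_sin_of_le {y : ℝ} (hy : 0 < y) (hy' : y ≤ 0.11) : 0.99 * y < Real.sin y := by
  have h := Real.sin_gt_sub_cube hy
  nlinarith [mul_pos hy hy, mul_nonneg hy.le (mul_nonneg (sub_nonneg.2 hy') (by linarith : 0 ≤ 0.11 + y))]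

theorem lt_sqrt_three_mul_pi : 3.0699 < Real.sqrt (3 * π) :=
  Real.lt_sqrt_of_sq_lt (by linarith [Real.pi_gt_d6])

theorem two_mul_one_div_sqrt_two_mul_sin_le {n : ℝ} (hn : 30 ≤ n) :
    2 * (1 / (Real.sqrt 2 * Real.sin (π / n))) ≤ 0.455 * n := by
  have hn0 : 0 < n := by linarith
  have hsin : 0.99 * (π / n) < Real.sin (π / n) :=
    mul_lt_sin_of_le (by positivity) ((div_le_iff₀ hn0).2 (by linarith [Real.pi_lt_d2]))
  have hsin' : 3.11 / n < Real.sin (π / n) := by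
    refine lt_of_le_of_lt ?_ hsin
    rw [← mul_div_assoc]
    gcongr
    linarith [Real.pi_gt_d4]
  have hsqrt : 1.4142 < Real.sqrt 2 := Real.lt_sqrt_of_sq_lt (by norm_num)
  have hprod : 1.4142 * (3.11 / n) ≤ Real.sqrt 2 * Real.sin (π / n) := by gcongr
  calc 2 * (1 / (Real.sqrt 2 * Real.sin (π / n))) ≤ 2 * (1 / (1.4142 * (3.11 / n))) := by gcongr
    _ = 2 / (1.4142 * 3.11) * n := by field_simp
    _ ≤ 0.455 * n := by gcongr; norm_num

theorem stmt_11 (g : ℕ) (hg : 3 ≤ g) :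
    4 * π * ((g : ℝ) - 1) +
        4 * arccosh (1 / (Real.sqrt 2 * Real.sin (π / (12 * (g : ℝ) - 6)))) <
      6 * Real.sqrt (3 * π) * ((g : ℝ) - 1) := by
  have hg' : (3 : ℝ) ≤ g := by exact_mod_cast hg
  have hn : 30 ≤ 12 * (g : ℝ) - 6 := by linarith
  have hsin : 0 < Real.sin (π / (12 * (g : ℝ) - 6)) :=
    Real.sin_pos_of_pos_of_lt_pi (div_pos Real.pi_pos (by linarith))
      (div_lt_self Real.pi_pos (by linarith))
  have hx : 0 < 1 / (Real.sqrt 2 * Real.sin (π / (12 * (g : ℝ) - 6))) := by positivity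
  have hlog : arccosh (1 / (Real.sqrt 2 * Real.sin (π / (12 * (g : ℝ) - 6)))) ≤
      0.0617 * (12 * (g : ℝ) - 6) + 1 := by
    refine (arccosh_le_log_two_mul hx).trans ((log_le_div_exp_two_add_one (by positivity)).trans ?_)
    gcongr
    rw [div_le_iff₀ (Real.exp_pos 2)]
    have hexp := lt_exp_two
    have hnum := two_mul_one_div_sqrt_two_mul_sin_le hn
    nlinarith
  have hcoef : 5.85 * ((g : ℝ) - 1) ≤ (6 * Real.sqrt (3 * π) - 4 * π) * ((g : ℝ) - 1) :=
    mul_le_mul_of_nonneg_right (by linarith [lt_sqrt_three_mul_pi, Real.pi_lt_d4]) (by linarith)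
  linarith
end
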